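/- Let α_1, …, α_ℓ ∈ R with ℓ ≥ 2 be Q_+-independent mod 1, and let K ⊂ T be a nonempty closed (α_1, …, α_ℓ)-set (i.e., K ⊂ ∪_{i=1}^ℓ (K − π(α_i))). If ℓ = 2, then either K − K = T or K has non-empty interior, and in particular the lower box-counting dimension of K is at least 1/2. -/

import Mathlib

open Filter Metric Set Pointwise

/-- The smallest number of arcs of length `δ` (closed balls of radius `δ/2`)
needed to cover `A`. -/
noncomputable def coverNum {X : Type*} [PseudoMetricSpace X] (A : Set X) (δ : ℝ) : ℕ :=
  sInf {n : ℕ | ∃ S : Finset X, S.card = n ∧ A ⊆ ⋃ x ∈ S, Metric.closedBall x (δ / 2)}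

/-- Lower box-counting dimension: liminf_{δ→0⁺} log N_δ(A) / log(1/δ). -/
noncomputable def lowerBoxDim {X : Type*} [PseudoMetricSpace X] (A : Set X) : ℝ :=
  Filter.liminf (fun δ : ℝ => Real.log (coverNum A δ) / Real.log (1 / δ))
    (nhdsWithin 0 (Set.Ioi 0))


/-- A set `K` each of whose points can be moved by `b + g` or by `b` without leaving `K` contains
an orbit whose `n`-th term has made `a n` of its steps by `b + g`. -/
lemma exists_orbit {G : Type*} [AddCommGroup G] {K : Set G} {b g : G} (hne : K.Nonempty)
    (hK : ∀ x ∈ K, x + (b + g) ∈ K ∨ x + b ∈ K) :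
    ∃ x₀ : G, ∃ a : ℕ → ℤ, a 0 = 0 ∧ (∀ n, a (n + 1) = a n ∨ a (n + 1) = a n + 1) ∧
      ∀ n : ℕ, x₀ + n • b + a n • g ∈ K := by
  have hK' : ∀ x : K, ∃ e : ℤ, (e = 0 ∨ e = 1) ∧ (x : G) + b + e • g ∈ K := by
    rintro ⟨x, hx⟩
    rcases hK x hx with h | h
    · exact ⟨1, Or.inr rfl, by simpa [add_assoc] using h⟩
    · exact ⟨0, Or.inl rfl, by simpa using h⟩
  choose e he hmem using hK'
  obtain ⟨x₀, hx₀⟩ := hne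
  let y : ℕ → K := fun n => (fun x : K => (⟨_, hmem x⟩ : K))^[n] ⟨x₀, hx₀⟩
  have hy : ∀ n, (y (n + 1)).1 = (y n).1 + b + e (y n) • g := fun n => by
    simp only [y, Function.iterate_succ_apply']
  refine ⟨x₀, fun n => ∑ i ∈ Finset.range n, e (y i), by simp, fun n => ?_, fun n => ?_⟩
  · simp only [Finset.sum_range_succ]
    rcases he (y n) with h | h <;> simp [h]
  · suffices x₀ + n • b + (∑ i ∈ Finset.range n, e (y i)) • g = y n from this ▸ (y n).2
    induction n with
    | zero => simp [y]
    | succ n ih =>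
      rw [hy, ← ih, Finset.sum_range_succ, succ_nsmul, add_smul]
      abel

/-- An integer sequence moving by at most one at each step attains all intermediate values. -/
lemma exists_eq_of_abs_succ_sub_le_one {f : ℕ → ℤ} (hf : ∀ n, |f (n + 1) - f n| ≤ 1)
    {n n' : ℕ} {j : ℤ} (h : f n ≤ j) (h' : j ≤ f n') : ∃ k, f k = j := by
  have up : ∀ f : ℕ → ℤ, (∀ n, |f (n + 1) - f n| ≤ 1) → ∀ (j : ℤ) (n d : ℕ),
      f n ≤ j → j ≤ f (n + d) → ∃ k, f k = j := by
    intro f hf j n d hn hd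
    induction d with
    | zero => exact ⟨n, le_antisymm hn hd⟩
    | succ d ih =>
      by_cases hj : j ≤ f (n + d)
      · exact ih hj
      · have := abs_le.1 (hf (n + d))
        exact ⟨n + (d + 1), by rw [← add_assoc] at *; omega⟩
  rcases le_total n n' with hnn | hnn <;> obtain ⟨d, rfl⟩ := Nat.exists_eq_add_of_le hnn
  · exact up f hf j n d h h'
  · obtain ⟨k, hk⟩ := up (fun n => -f n)
      (fun n => by rw [abs_le]; have := abs_le.1 (hf n); omega) (-j) n' d (by simpa) (by simpa)
    exact ⟨k, by simpa using hk⟩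

/-- If `g` has dense multiples in a compact group, then finitely many of them are `ε`-dense. -/
lemma exists_forall_exists_norm_sub_zsmul_lt {G : Type*} [SeminormedAddCommGroup G] [CompactSpace G]
    {g : G} (hg : DenseRange (· • g : ℤ → G)) {ε : ℝ} (hε : 0 < ε) :
    ∃ N : ℕ, ∀ u : G, ∃ j : ℤ, |j| ≤ N ∧ ‖u - j • g‖ < ε := by
  obtain ⟨t, ht⟩ := isCompact_univ.elim_finite_subcover
    (fun j : ℤ => Metric.ball (j • g) ε) (fun _ => Metric.isOpen_ball) (fun u _ => by
      obtain ⟨j, hj⟩ := hg.exists_dist_lt u hε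
      exact mem_iUnion.2 ⟨j, hj⟩)
  refine ⟨t.sup Int.natAbs, fun u => ?_⟩
  obtain ⟨j, hj, hu⟩ := mem_iUnion₂.1 (ht (mem_univ u))
  refine ⟨j, ?_, by rwa [mem_ball, dist_eq_norm] at hu⟩
  have : j.natAbs ≤ t.sup Int.natAbs := Finset.le_sup (f := Int.natAbs) hj
  rw [Int.abs_eq_natAbs]
  exact_mod_cast this

/-- An orbit whose step counts over windows of equal length have unbounded discrepancy has
difference set everything. -/
lemma sub_eq_univ_of_unbounded {G : Type*} [NormedAddCommGroup G] [CompactSpace G]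
    {K : Set G} (hKcl : IsClosed K) {b g x₀ : G} (hg : DenseRange (· • g : ℤ → G))
    {a : ℕ → ℤ} (ha : ∀ n, a (n + 1) = a n ∨ a (n + 1) = a n + 1)
    (hx : ∀ n : ℕ, x₀ + n • b + a n • g ∈ K)
    (hunb : ∀ M : ℤ, ∃ k n n', M < a (n + k) - a n - (a (n' + k) - a n')) :
    K - K = univ := by
  have hcl : IsClosed (K - K) := by
    rw [← sub_image_prod]
    exact ((hKcl.isCompact.prod hKcl.isCompact).image continuous_sub).isClosed
  refine eq_univ_of_forall fun u => ?_
  rw [← hcl.closure_eq, Metric.mem_closure_iff]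
  intro ε hε
  obtain ⟨N, hN⟩ := exists_forall_exists_norm_sub_zsmul_lt hg hε
  obtain ⟨k, n, n', h⟩ := hunb (2 * N)
  set f : ℕ → ℤ := fun n => a (n + k) - a n with hf
  obtain ⟨j, hj, hjε⟩ := hN (u - k • b - (f n' + N) • g)
  obtain ⟨i, hi⟩ := exists_eq_of_abs_succ_sub_le_one (f := f) (n := n') (n' := n)
    (j := f n' + N + j) (fun i => by
      have h1 := ha i
      have h2 := ha (i + k)
      simp only [hf, abs_le, add_right_comm i 1 k]
      omega)
    (by have := abs_le.1 hj; omega) (by have := abs_le.1 hj; simp only [hf]; omega)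
  refine ⟨_, sub_mem_sub (hx (i + k)) (hx i), ?_⟩
  rw [dist_eq_norm]
  convert hjε using 2
  have : a (i + k) = a i + (f n' + N + j) := by rw [← hi]; simp [hf]
  rw [this, add_smul, add_smul, add_smul, add_smul]
  abel

/-- A sequence with steps `0` or `1` and bounded discrepancy over windows of equal length stays at
bounded distance from a linear function with slope in `[0, 1]`. -/
lemma exists_slope {a : ℕ → ℤ} (h0 : a 0 = 0) (ha : ∀ n, a (n + 1) = a n ∨ a (n + 1) = a n + 1)
    {M : ℤ} (hM : ∀ k n n', a (n + k) - a n - (a (n' + k) - a n') ≤ M) :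
    ∃ ρ : ℝ, 0 ≤ ρ ∧ ρ ≤ 1 ∧ ∀ n, |(a n : ℝ) - n * ρ| ≤ M := by
  have hnn : ∀ n, 0 ≤ a n ∧ a n ≤ n := by
    intro n
    induction n with
    | zero => simp [h0]
    | succ n ih => push_cast; have := ha n; omega
  have hMR : ∀ k n n', (a (n + k) : ℝ) - a n - (a (n' + k) - a n') ≤ M := by
    exact_mod_cast hM
  have hM0 : (0 : ℝ) ≤ M := by simpa using hMR 0 0 0
  have hnnR : ∀ n, (0 : ℝ) ≤ a n ∧ (a n : ℝ) ≤ n := fun n => by exact_mod_cast hnn n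
  have hu : Subadditive fun n => (a n : ℝ) + M := fun m n => by
    have := hMR n m 0
    simp only [zero_add, h0, Int.cast_zero] at this
    linarith
  have hv : Subadditive fun n => (M : ℝ) - a n := fun m n => by
    have := hMR n 0 m
    simp only [zero_add, h0, Int.cast_zero] at this
    linarith
  have hub : BddBelow (range fun n : ℕ => ((a n : ℝ) + M) / n) := by
    refine ⟨0, ?_⟩
    rintro _ ⟨n, rfl⟩
    have := (hnnR n).1
    positivity
  have hvb : BddBelow (range fun n : ℕ => ((M : ℝ) - a n) / n) := by
    refine ⟨-1, ?_⟩
    rintro _ ⟨n, rfl⟩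
    rcases n.eq_zero_or_pos with rfl | hn
    · simp
    · have hn' : (0 : ℝ) < n := by exact_mod_cast hn
      simp only [le_div_iff₀ hn']
      linarith [(hnnR n).2]
  have hMn : Tendsto (fun n : ℕ => (M : ℝ) / n) atTop (nhds 0) :=
    tendsto_const_div_atTop_nhds_zero_nat _
  have ht := (hu.tendsto_lim hub).sub hMn
  have ht' : Tendsto (fun n : ℕ => (a n : ℝ) / n) atTop (nhds hu.lim) := by
    simpa [add_div] using ht
  have hlim : hv.lim = -hu.lim := by
    refine tendsto_nhds_unique (hv.tendsto_lim hvb) ?_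
    simpa [sub_div] using hMn.sub ht'
  refine ⟨hu.lim, ge_of_tendsto' ht' fun n => ?_, le_of_tendsto' ht' fun n => ?_, fun n => ?_⟩
  · have := (hnnR n).1
    positivity
  · exact div_le_one_of_le₀ (hnnR n).2 (by positivity)
  · rcases n.eq_zero_or_pos with rfl | hn
    · simpa [h0] using hM0
    · have hn' : (0 : ℝ) < n := by exact_mod_cast hn
      have h1 := hu.lim_le_div hub hn.ne'
      have h2 := hv.lim_le_div hvb hn.ne'
      rw [le_div_iff₀ hn'] at h1 h2
      rw [hlim] at h2
      rw [abs_le]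
      constructor <;> linarith

/-- Simultaneous recurrence of the rotation by `b` and of its deviation, at arbitrarily late
times. -/
lemma exists_recurrence {G : Type*} [SeminormedAddCommGroup G] [CompactSpace G] (b g : G) (ρ : ℝ)
    (N : ℕ) {ε : ℝ} (hε : 0 < ε) :
    ∃ k : ℕ, N ≤ k ∧ ∃ m : ℤ, ‖k • b + m • g‖ < ε ∧ |(m : ℝ) - k * ρ| < ε := by
  let c : ℕ → ℤ := fun n => ⌊n * ρ⌋
  let z : ℕ → G × ℝ := fun n => (n • b + c n • g, c n - n * ρ)
  have hz : ∀ n, z n ∈ (univ : Set G) ×ˢ Icc (-1 : ℝ) 0 := fun n => by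
    refine ⟨mem_univ _, ?_, ?_⟩
    · have := Int.lt_floor_add_one ((n : ℝ) * ρ)
      simp only [z, c]; linarith
    · have := Int.floor_le ((n : ℝ) * ρ)
      simp only [z, c]; linarith
  obtain ⟨p, -, φ, hφ, hlim⟩ := (isCompact_univ.prod isCompact_Icc).isSeqCompact hz
  obtain ⟨i, hi⟩ := Metric.cauchySeq_iff.1 hlim.cauchySeq ε hε
  have h := hi (φ i + N + i) (by omega) i le_rfl
  have hge : φ i + N ≤ φ (φ i + N + i) := (by omega : _ ≤ φ i + N + i).trans (hφ.id_le _)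
  simp only [Function.comp, Prod.dist_eq, max_lt_iff] at h
  obtain ⟨k, hk⟩ := Nat.exists_eq_add_of_le hge
  rw [hk] at h
  refine ⟨N + k, by omega, c (φ i + N + k) - c (φ i), ?_, ?_⟩
  · have h1 := h.1
    rw [dist_eq_norm] at h1
    refine lt_of_eq_of_lt (congrArg norm ?_) h1
    simp only [z, add_smul, sub_smul]
    abel
  · have h2 := h.2
    rw [Real.dist_eq] at h2
    refine lt_of_eq_of_lt (congrArg abs ?_) h2
    simp only [z]
    push_cast
    ring

/-- Every element of the unit circle has a real lift of the same absolute value. -/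
lemma UnitAddCircle.exists_coe_eq_abs_eq_norm (p : UnitAddCircle) :
    ∃ x : ℝ, (x : UnitAddCircle) = p ∧ |x| = ‖p‖ := by
  obtain ⟨y, rfl⟩ := QuotientAddGroup.mk_surjective p
  refine ⟨y - round y, ?_, (UnitAddCircle.norm_eq (x := y)).symm⟩
  rw [AddCircle.coe_sub, sub_eq_self]
  exact AddCircle.coe_eq_zero_iff (1 : ℝ) |>.2 ⟨round y, by simp⟩

/-- The multiples of a nonzero `p` up to order `1 / ‖p‖` are `‖p‖`-dense in the circle. -/
lemma UnitAddCircle.exists_norm_zsmul_sub_le {p : UnitAddCircle} (hp : p ≠ 0) (u : UnitAddCircle) :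
    ∃ s : ℤ, ‖s • p - u‖ ≤ ‖p‖ ∧ |(s : ℝ)| * ‖p‖ ≤ 1 := by
  have hhalf : ∀ v : UnitAddCircle, ‖v‖ ≤ 1 / 2 := fun v => by
    simpa using AddCircle.norm_le_half_period (1 : ℝ) (x := v) one_ne_zero
  have hp2 := hhalf p
  have hu2 := hhalf u
  have hp0 : 0 < ‖p‖ := norm_pos_iff.2 hp
  obtain ⟨x, rfl, hx⟩ := exists_coe_eq_abs_eq_norm p
  obtain ⟨y, rfl, hy⟩ := exists_coe_eq_abs_eq_norm u
  rw [← hx] at hp2 hp0 ⊢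
  rw [← hy] at hu2
  have hx0 : x ≠ 0 := abs_pos.1 hp0
  have hs : |round (y / x) * x - y| ≤ |x| / 2 := by
    have : round (y / x) * x - y = -((y / x - round (y / x)) * x) := by field_simp; ring
    rw [this, abs_neg, abs_mul]
    have := abs_sub_round (y / x)
    nlinarith
  refine ⟨round (y / x), ?_, ?_⟩
  · rw [← AddCircle.coe_zsmul, ← AddCircle.coe_sub, zsmul_eq_mul]
    refine (UnitAddCircle.norm_eq (x := _)).trans_le (((round_le _ 0).trans ?_).trans
      (by linarith : |x| / 2 ≤ |x|))
    simpa using hs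
  · rw [← abs_mul]
    have := abs_sub_abs_le_abs_sub (round (y / x) * x) y
    linarith

/-- The combinations `n • b + m • g` with `m` close to `n * ρ` are dense in the circle. -/
lemma exists_bound_forall_exists_int {b g : UnitAddCircle} {ρ : ℝ}
    (hg : DenseRange (· • g : ℤ → UnitAddCircle))
    (hnz : ∀ (k : ℕ) (m : ℤ), 0 < k → k • b + m • g = 0 → (m : ℝ) ≠ k * ρ) :
    ∃ C : ℝ, ∀ u : UnitAddCircle, ∀ ε > 0, ∃ n m : ℤ,
      ‖n • b + m • g - u‖ < ε ∧ |(m : ℝ) - n * ρ| ≤ C := by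
  by_cases hI : ∃ C : ℝ, ∀ ε > 0, ∃ n m : ℤ, n • b + m • g ≠ 0 ∧ ‖n • b + m • g‖ < ε ∧
      |(m : ℝ) - n * ρ| ≤ C * ‖n • b + m • g‖
  · obtain ⟨C, hC⟩ := hI
    refine ⟨|C|, fun u ε hε => ?_⟩
    obtain ⟨n, m, hp, hpε, hr⟩ := hC ε hε
    obtain ⟨s, hs, hs1⟩ := UnitAddCircle.exists_norm_zsmul_sub_le hp u
    refine ⟨s * n, s * m, ?_, ?_⟩
    · rw [mul_smul, mul_smul, ← smul_add]
      exact hs.trans_lt hpε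
    · calc |((s * m : ℤ) : ℝ) - (s * n : ℤ) * ρ| = |(s : ℝ)| * |(m : ℝ) - n * ρ| := by
            rw [← abs_mul]; push_cast; ring_nf
        _ ≤ |(s : ℝ)| * (|C| * ‖n • b + m • g‖) := by
            gcongr
            exact hr.trans (by gcongr; exact le_abs_self C)
        _ = |C| * (|(s : ℝ)| * ‖n • b + m • g‖) := by ring
        _ ≤ |C| := mul_le_of_le_one_right (abs_nonneg C) hs1
  · push Not at hI
    refine ⟨1, fun u ε hε => ?_⟩
    obtain ⟨c, hc⟩ := hg.exists_dist_lt u (half_pos hε)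
    have hC0 : 0 < 2 * (|(c : ℝ)| + 1) / ε := by positivity
    obtain ⟨ε', hε', H⟩ := hI (2 * (|(c : ℝ)| + 1) / ε)
    obtain ⟨k, hk, m, hp, hr⟩ := exists_recurrence b g ρ 1 (lt_min hε' one_pos)
    rw [lt_min_iff] at hp hr
    have hr0 : (m : ℝ) - k * ρ ≠ 0 := by
      intro h0
      by_cases hp0 : k • b + m • g = 0
      · exact hnz k m hk hp0 (sub_eq_zero.1 h0)
      · have := H k m (by simpa using hp0) (by simpa using hp.1)
        simp only [natCast_zsmul, Int.cast_natCast, h0, abs_zero] at this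
        exact absurd this (not_lt.2 (by positivity))
    have hpr : 2 * (|(c : ℝ)| + 1) / ε * ‖k • b + m • g‖ ≤ |(m : ℝ) - k * ρ| := by
      by_cases hp0 : k • b + m • g = 0
      · simp [hp0]
      · simpa using (H k m (by simpa using hp0) (by simpa using hp.1)).le
    set r := (m : ℝ) - k * ρ with hrdef
    set s := round (c / r) with hsdef
    have hs : |(c : ℝ) - s * r| ≤ |r| / 2 := by
      have h1 : (c : ℝ) - s * r = (c / r - s) * r := by field_simp
      rw [h1, abs_mul]
      have := abs_sub_round (c / r)
      nlinarith [abs_nonneg r]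
    have hsr : |(s : ℝ)| * |r| ≤ |(c : ℝ)| + 1 := by
      rw [← abs_mul]
      have := abs_sub_abs_le_abs_sub (s * r) c
      rw [abs_sub_comm] at this
      linarith [hr.2]
    have hsp : ‖s • (k • b + m • g)‖ ≤ ε / 2 := by
      refine (norm_zsmul_le _ _).trans ?_
      rw [Int.norm_eq_abs]
      have h1 : 2 * (|(c : ℝ)| + 1) / ε * (|(s : ℝ)| * ‖k • b + m • g‖) ≤ |(c : ℝ)| + 1 := by
        refine le_trans ?_ hsr
        rw [mul_left_comm]
        gcongr
      rw [div_mul_eq_mul_div, div_le_iff₀ hε] at h1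
      have : 0 < |(c : ℝ)| + 1 := by positivity
      nlinarith
    refine ⟨-s * k, c - s * m, ?_, ?_⟩
    · have h1 : (-s * k : ℤ) • b + (c - s * m : ℤ) • g - u
          = -(u - c • g) - s • (k • b + m • g) := by
        simp only [neg_mul, neg_smul, sub_smul, mul_smul, smul_add, natCast_zsmul]
        abel
      rw [h1]
      refine (norm_sub_le _ _).trans_lt ?_
      rw [norm_neg]
      rw [dist_eq_norm] at hc
      linarith
    · have h1 : ((c - s * m : ℤ) : ℝ) - (-s * k : ℤ) * ρ = c - s * r := by
        rw [hrdef]; push_cast; ring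
      rw [h1]
      linarith [hr.2]

/-- The combinations `n • b + m • g` with `n` a natural number and `m` close to `n * ρ` are dense
in the circle. -/
lemma exists_bound_forall_exists_nat {b g : UnitAddCircle} {ρ : ℝ}
    (hg : DenseRange (· • g : ℤ → UnitAddCircle))
    (hnz : ∀ (k : ℕ) (m : ℤ), 0 < k → k • b + m • g = 0 → (m : ℝ) ≠ k * ρ) :
    ∃ C : ℝ, ∀ u : UnitAddCircle, ∀ ε > 0, ∃ (n : ℕ) (m : ℤ),
      ‖n • b + m • g - u‖ < ε ∧ |(m : ℝ) - n * ρ| ≤ C := by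
  obtain ⟨C, hC⟩ := exists_bound_forall_exists_int hg hnz
  refine ⟨C + 1, fun u ε hε => ?_⟩
  obtain ⟨n, m, h1, h2⟩ := hC u (ε / 2) (half_pos hε)
  obtain ⟨k, hk, l, h3, h4⟩ :=
    exists_recurrence b g ρ n.natAbs (lt_min (half_pos hε) one_pos)
  rw [lt_min_iff] at h3 h4
  obtain ⟨q, hq⟩ := Int.eq_ofNat_of_zero_le (by omega : 0 ≤ n + k)
  have hqR : (q : ℝ) = n + k := by exact_mod_cast hq.symm
  refine ⟨q, m + l, ?_, ?_⟩
  · have h5 : q • b + (m + l) • g - u = (n • b + m • g - u) + (k • b + l • g) := by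
      rw [← natCast_zsmul b q, ← hq, add_smul, add_smul, natCast_zsmul]
      abel
    rw [h5]
    exact (norm_add_le _ _).trans_lt (by linarith [h3.1])
  · have h5 : ((m + l : ℤ) : ℝ) - q * ρ = (m - n * ρ) + (l - k * ρ) := by
      rw [hqR]; push_cast; ring
    rw [h5]
    exact (abs_add_le _ _).trans (by linarith [h4.2])

/-- If the combinations `n • b + m • g` with `m` at bounded distance from `a n` are dense, then
finitely many translates of the orbit closure cover, so that it has nonempty interior. -/
lemma nonempty_interior_of_dense {G : Type*} [SeminormedAddCommGroup G] [CompactSpace G]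
    {K : Set G} (hKcl : IsClosed K) {b g x₀ : G} {a : ℕ → ℤ}
    (hx : ∀ n : ℕ, x₀ + n • b + a n • g ∈ K) {C : ℤ}
    (hd : ∀ u : G, ∀ ε > 0, ∃ (n : ℕ) (m : ℤ), ‖n • b + m • g - u‖ < ε ∧ |m - a n| ≤ C) :
    (interior K).Nonempty := by
  let F : Icc (-C) C → Set G := fun j => Homeomorph.addLeft (x₀ - (j : ℤ) • g) ⁻¹' K
  have hF : ∀ j, IsClosed (F j) := fun j => hKcl.preimage (Homeomorph.continuous _)
  have hU : ⋃ j, F j = univ := by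
    refine eq_univ_of_forall fun u => ?_
    rw [← (isClosed_iUnion_of_finite hF).closure_eq, Metric.mem_closure_iff]
    intro ε hε
    obtain ⟨n, m, h1, h2⟩ := hd u ε hε
    refine ⟨n • b + m • g, mem_iUnion.2 ⟨⟨m - a n, abs_le.1 h2⟩, ?_⟩, ?_⟩
    · change x₀ - (m - a n) • g + (n • b + m • g) ∈ K
      convert hx n using 1
      rw [sub_smul]
      abel
    · rwa [dist_comm, dist_eq_norm]
  obtain ⟨j, y, hy⟩ := nonempty_interior_of_iUnion_of_closed hF hU
  rw [← Homeomorph.preimage_interior] at hy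
  exact ⟨_, hy⟩

/-- A nonempty closed subset of the circle stable under choosing one of two translations either
has full difference set or has nonempty interior. -/
lemma sub_eq_univ_or_nonempty_interior {b g : UnitAddCircle}
    (hind : ∀ p q : ℕ, p • (b + g) + q • b = 0 → p = 0 ∧ q = 0)
    {K : Set UnitAddCircle} (hKne : K.Nonempty) (hKcl : IsClosed K)
    (hK : ∀ x ∈ K, x + (b + g) ∈ K ∨ x + b ∈ K) :
    K - K = univ ∨ (interior K).Nonempty := by
  obtain ⟨x₀, a, h0, ha, hx⟩ := exists_orbit hKne hK
  by_cases hg : addOrderOf g = 0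
  · rw [← AddCircle.denseRange_zsmul_iff] at hg
    by_cases hunb : ∀ M : ℤ, ∃ k n n', M < a (n + k) - a n - (a (n' + k) - a n')
    · exact Or.inl (sub_eq_univ_of_unbounded hKcl hg ha hx hunb)
    · right
      push Not at hunb
      obtain ⟨M, hM⟩ := hunb
      obtain ⟨ρ, hρ0, hρ1, hρ⟩ := exists_slope h0 ha hM
      have hnz : ∀ (k : ℕ) (m : ℤ), 0 < k → k • b + m • g = 0 → (m : ℝ) ≠ k * ρ := by
        intro k m hk hz hm
        have hm0 : (0 : ℝ) ≤ m := hm ▸ by positivity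
        have hmk : (m : ℝ) ≤ k := hm ▸ mul_le_of_le_one_right (by positivity) hρ1
        lift m to ℕ using by exact_mod_cast hm0
        have hmk' : m ≤ k := by exact_mod_cast hmk
        obtain ⟨q, rfl⟩ := Nat.exists_eq_add_of_le hmk'
        have := hind m q (by rw [← hz, natCast_zsmul, smul_add, add_smul]; abel)
        omega
      obtain ⟨C, hC⟩ := exists_bound_forall_exists_nat hg hnz
      refine nonempty_interior_of_dense hKcl hx (C := ⌈C⌉ + M) fun u ε hε => ?_
      obtain ⟨n, m, h1, h2⟩ := hC u ε hε
      refine ⟨n, m, h1, ?_⟩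
      have h3 : |(m : ℝ) - a n| ≤ ⌈C⌉ + M := by
        have h4 : (m : ℝ) - a n = (m - n * ρ) - (a n - n * ρ) := by ring
        rw [h4]
        exact (abs_sub _ _).trans (add_le_add (h2.trans (Int.le_ceil C)) (hρ n))
      exact_mod_cast h3
  · right
    have hb : addOrderOf b = 0 := by
      by_contra hb
      exact hb (hind 0 (addOrderOf b) (by simp)).2
    rw [← AddCircle.denseRange_zsmul_iff, denseRange_zsmul_iff_nsmul] at hb
    refine nonempty_interior_of_dense hKcl hx (C := addOrderOf g) fun u ε hε => ?_
    obtain ⟨n, hn⟩ := hb.exists_dist_lt u hε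
    refine ⟨n, addOrderOf g * (a n / addOrderOf g), ?_, ?_⟩
    · rw [mul_comm, mul_smul, natCast_zsmul, addOrderOf_nsmul_eq_zero, smul_zero, add_zero,
        ← dist_eq_norm, dist_comm]
      exact hn
    · have h1 := Int.emod_add_mul_ediv (a n) (addOrderOf g)
      have h2 := Int.emod_nonneg (a n) (b := addOrderOf g) (by exact_mod_cast hg)
      have h3 := Int.emod_lt_of_pos (a n) (b := addOrderOf g) (by omega)
      rw [abs_le]
      constructor <;> linarith

/-- The covering number of a compact set is attained. -/
lemma exists_card_eq_coverNum {X : Type*} [PseudoMetricSpace X] {A : Set X} (hA : IsCompact A)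
    {δ : ℝ} (hδ : 0 < δ) :
    ∃ S : Finset X, S.card = coverNum A δ ∧ A ⊆ ⋃ x ∈ S, Metric.closedBall x (δ / 2) := by
  refine Nat.sInf_mem (s := {n : ℕ | ∃ S : Finset X, S.card = n ∧
    A ⊆ ⋃ x ∈ S, Metric.closedBall x (δ / 2)}) ?_
  obtain ⟨t, -, ht, hcov⟩ := hA.finite_cover_balls (half_pos hδ)
  refine ⟨_, ht.toFinset, rfl, hcov.trans ?_⟩
  simp only [Set.Finite.mem_toFinset]
  exact iUnion₂_mono fun x _ => Metric.ball_subset_closedBall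

/-- The circle is covered by `n` arcs of length `1 / n`. -/
lemma UnitAddCircle.coverNum_le (K : Set UnitAddCircle) {n : ℕ} (hn : 0 < n) :
    coverNum K (1 / n) ≤ n := by
  classical
  have hn' : (0 : ℝ) < n := by exact_mod_cast hn
  let S : Finset UnitAddCircle :=
    (Finset.range n).image fun i : ℕ => (((i + 1 / 2) / n : ℝ) : UnitAddCircle)
  have hS : K ⊆ ⋃ x ∈ S, Metric.closedBall x (1 / n / 2 : ℝ) := by
    intro u _
    obtain ⟨y, hy, rfl⟩ : ∃ y ∈ Ico (0 : ℝ) 1, (y : UnitAddCircle) = u := by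
      have := AddCircle.coe_image_Ico_eq (1 : ℝ) 0
      simpa using this.ge (mem_univ u)
    have hny : 0 ≤ n * y := mul_nonneg hn'.le hy.1
    have h1 := Nat.floor_le hny
    have h2 := Nat.lt_floor_add_one (n * y)
    have hlt : ⌊n * y⌋₊ < n := (Nat.floor_lt hny).2 (by nlinarith [hy.2])
    refine mem_iUnion₂.2 ⟨_, Finset.mem_image_of_mem _ (Finset.mem_range.2 hlt), ?_⟩
    rw [mem_closedBall, dist_eq_norm, ← AddCircle.coe_sub]
    refine (UnitAddCircle.norm_eq (x := _)).trans_le ((round_le _ 0).trans ?_)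
    have h3 : y - (⌊n * y⌋₊ + 1 / 2) / n = (n * y - ⌊n * y⌋₊ - 1 / 2) / n := by
      field_simp
      ring
    rw [Int.cast_zero, sub_zero, h3, abs_div, abs_of_pos hn', div_right_comm]
    gcongr
    rw [abs_le]
    constructor <;> linarith
  calc coverNum K (1 / n) ≤ S.card := Nat.sInf_le ⟨S, rfl, hS⟩
    _ ≤ n := Finset.card_image_le.trans (Finset.card_range n).le

/-- If the squared covering numbers grow at least like `1 / δ`, then the lower box-counting
dimension is at least `1 / 2`. -/
lemma UnitAddCircle.half_le_lowerBoxDim {K : Set UnitAddCircle} {c : ℝ} (hc : 0 < c)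
    (h : ∀ δ > 0, c ≤ δ * (coverNum K δ : ℝ) ^ 2) : 1 / 2 ≤ lowerBoxDim K := by
  have hlog : Tendsto (fun δ : ℝ => Real.log (1 / δ)) (nhdsWithin 0 (Ioi 0)) atTop := by
    simp only [one_div]
    exact Real.tendsto_log_atTop.comp tendsto_inv_nhdsGT_zero
  have hcob : (nhdsWithin (0 : ℝ) (Ioi 0)).IsCoboundedUnder (· ≥ ·)
      fun δ : ℝ => Real.log (coverNum K δ) / Real.log (1 / δ) := by
    refine IsCobounded.of_frequently_le (l := 1) ?_
    have hseq : Tendsto (fun n : ℕ => 1 / (n : ℝ)) atTop (nhdsWithin 0 (Ioi 0)) := by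
      simp only [one_div]
      exact tendsto_inv_atTop_nhdsGT_zero.comp tendsto_natCast_atTop_atTop
    refine frequently_map.2 (hseq.frequently (Eventually.frequently ?_))
    filter_upwards [eventually_gt_atTop 0] with n hn
    rw [one_div_one_div]
    refine div_le_one_of_le₀ ?_ (Real.log_natCast_nonneg n)
    rcases (coverNum K (1 / n)).eq_zero_or_pos with h0 | h0
    · rw [h0, Nat.cast_zero, Real.log_zero]
      exact Real.log_natCast_nonneg n
    · exact Real.log_le_log (by exact_mod_cast h0) (by exact_mod_cast coverNum_le K hn)
  have hlim : Tendsto (fun δ : ℝ => 1 / 2 + Real.log c / 2 / Real.log (1 / δ))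
      (nhdsWithin 0 (Ioi 0)) (nhds (1 / 2)) := by
    simpa using tendsto_const_nhds.add (hlog.const_div_atTop (Real.log c / 2))
  rw [lowerBoxDim, ← hlim.liminf_eq]
  refine liminf_le_liminf ?_ hlim.isBoundedUnder_ge hcob
  filter_upwards [hlog.eventually_gt_atTop 0, self_mem_nhdsWithin] with δ hδ hδ0
  have hδ0 : 0 < δ := hδ0
  have hN := h δ hδ0
  have hN0 : (coverNum K δ : ℝ) ≠ 0 := fun h0 => by
    rw [h0] at hN
    norm_num at hN
    exact absurd hN (not_le.2 hc)
  have h1 := Real.log_le_log hc hN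
  rw [Real.log_mul hδ0.ne' (pow_ne_zero 2 hN0), Real.log_pow] at h1
  rw [le_div_iff₀ hδ, add_mul, div_mul_cancel₀ _ hδ.ne', one_div δ, Real.log_inv]
  push_cast at h1
  linarith

open MeasureTheory in
/-- A set covered by `n` closed balls of radius `r` in the circle has measure at most
`2 * r * n`. -/
lemma UnitAddCircle.volume_real_le {A : Set UnitAddCircle} {ι : Type*} (S : Finset ι)
    (f : ι → UnitAddCircle) {r : ℝ} (hr : 0 ≤ r) (h : A ⊆ ⋃ i ∈ S, closedBall (f i) r) :
    volume.real A ≤ S.card * (2 * r) := by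
  calc volume.real A ≤ volume.real (⋃ i ∈ S, closedBall (f i) r) :=
        measureReal_mono h (measure_ne_top _ _)
    _ ≤ ∑ i ∈ S, volume.real (closedBall (f i) r) := measureReal_biUnion_finset_le _ _
    _ ≤ ∑ _i ∈ S, 2 * r := Finset.sum_le_sum fun i _ => by
        rw [measureReal_def, AddCircle.volume_closedBall]
        exact ENNReal.toReal_le_of_le_ofReal (by positivity)
          (ENNReal.ofReal_le_ofReal (min_le_right _ _))
    _ = S.card * (2 * r) := by rw [Finset.sum_const, nsmul_eq_mul]

open MeasureTheory in
/-- A closed set with nonempty interior has lower box-counting dimension at least `1 / 2`. -/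
lemma UnitAddCircle.half_le_lowerBoxDim_of_nonempty_interior {K : Set UnitAddCircle}
    (hKcl : IsClosed K) (hK : (interior K).Nonempty) : 1 / 2 ≤ lowerBoxDim K := by
  have hpos : 0 < volume.real K :=
    ENNReal.toReal_pos (Measure.measure_pos_of_nonempty_interior volume hK).ne' (measure_ne_top _ _)
  refine half_le_lowerBoxDim hpos fun δ hδ => ?_
  obtain ⟨S, hS, hcov⟩ := exists_card_eq_coverNum hKcl.isCompact hδ
  have h1 := volume_real_le S id (half_pos hδ).le hcov
  rw [hS] at h1
  refine h1.trans ?_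
  have h2 : (coverNum K δ : ℝ) ≤ (coverNum K δ : ℝ) ^ 2 := by
    exact_mod_cast Nat.le_self_pow two_ne_zero _
  nlinarith

open MeasureTheory in
/-- A closed set with full difference set has lower box-counting dimension at least `1 / 2`. -/
lemma UnitAddCircle.half_le_lowerBoxDim_of_sub_eq_univ {K : Set UnitAddCircle}
    (hKcl : IsClosed K) (hK : K - K = univ) : 1 / 2 ≤ lowerBoxDim K := by
  refine half_le_lowerBoxDim (half_pos one_pos) fun δ hδ => ?_
  obtain ⟨S, hS, hcov⟩ := exists_card_eq_coverNum hKcl.isCompact hδ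
  have h1 := volume_real_le (A := univ) (S ×ˢ S) (fun p => p.1 - p.2) hδ.le (by
    rw [← hK]
    rintro _ ⟨x, hx, y, hy, rfl⟩
    obtain ⟨s, hs, hxs⟩ := mem_iUnion₂.1 (hcov hx)
    obtain ⟨t, ht, hyt⟩ := mem_iUnion₂.1 (hcov hy)
    refine mem_iUnion₂.2 ⟨(s, t), Finset.mem_product.2 ⟨hs, ht⟩, ?_⟩
    rw [mem_closedBall] at *
    exact (dist_sub_sub_le x y s t).trans (by linarith))
  rw [measureReal_def, AddCircle.measure_univ, ENNReal.toReal_ofReal zero_le_one,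
    Finset.card_product, hS] at h1
  push_cast at h1
  nlinarith

theorem stmt13 (α : Fin 2 → ℝ)
    (hindep : ∀ t : Fin 2 → ℚ, (∀ i, 0 ≤ t i) →
      ((∑ i, (t i : ℝ) * α i : ℝ) : AddCircle (1 : ℝ)) = 0 → t = 0)
    (K : Set (AddCircle (1 : ℝ))) (hKne : K.Nonempty) (hKcl : IsClosed K)
    (hK : K ⊆ ⋃ i, (fun y => y - ((α i : ℝ) : AddCircle (1 : ℝ))) '' K) :
    (K - K = Set.univ ∨ (interior K).Nonempty) ∧ 1 / 2 ≤ lowerBoxDim K := by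
  have hind : ∀ p q : ℕ, p • ((α 1 : UnitAddCircle) + (α 0 - α 1 : UnitAddCircle))
      + q • (α 1 : UnitAddCircle) = 0 → p = 0 ∧ q = 0 := by
    intro p q h
    have ht := hindep ![p, q] (by simp [Fin.forall_fin_two]) (by
      rw [add_sub_cancel, ← AddCircle.coe_nsmul, ← AddCircle.coe_nsmul, ← AddCircle.coe_add] at h
      simpa using h)
    exact ⟨by simpa using congrFun ht 0, by simpa using congrFun ht 1⟩
  have hstep : ∀ x ∈ K, x + ((α 1 : UnitAddCircle) + (α 0 - α 1 : UnitAddCircle)) ∈ K ∨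
      x + (α 1 : UnitAddCircle) ∈ K := by
    intro x hx
    obtain ⟨i, y, hy, rfl⟩ := mem_iUnion.1 (hK hx)
    fin_cases i
    · left; simpa using hy
    · right; simpa using hy
  have h := sub_eq_univ_or_nonempty_interior hind hKne hKcl hstep
  exact ⟨h, h.elim (UnitAddCircle.half_le_lowerBoxDim_of_sub_eq_univ hKcl)
    (UnitAddCircle.half_le_lowerBoxDim_of_nonempty_interior hKcl)⟩
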